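/- Let m ≥ 1, M = 2^m, and let d_0,…,d_{m−1} be positive real numbers. Define the hierarchical one-dimensional input alphabet X by x_i = Σ_{k=0}^{m−1} (2·b_k(i) − 1)·d_k for i = 0,…,M−1. Then X = Q(N_m)·V with V = (−d_0, −d_1, …, −d_{m−1})ᵀ, and consequently the constellation [X, N_m, U_M] (hierarchical alphabet labeled by the natural binary code, uniform distribution) is first-order optimal: Σ_{k=0}^{m−1} ((1/M) Σ_{i=0}^{M−1} q_{i,k} x_i)² = (1/M) Σ_{i=0}^{M−1} x_i². -/

import Mathlib

/-- Modified labeling matrix: `q_{i,k} = -1` if `c_{i,m-1-k} = 1`, `+1` otherwise. -/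
def Qmat (m : ℕ) (c : ℕ → ℕ → Bool) (i k : ℕ) : ℝ :=
  if c i (m - 1 - k) then -1 else 1

/-- Natural binary code: `c_{i,k} = b_{m-1-k}(i)` (MSB first). -/
def nbc (m i k : ℕ) : Bool := Nat.testBit i (m - 1 - k)

lemma Qmat_nbc (m i k : ℕ) (hk : k < m) :
    Qmat m (nbc m) i k = if Nat.testBit i k then -1 else 1 := by
  have h : m - 1 - (m - 1 - k) = k := by omega
  simp [Qmat, nbc, h]

lemma Qmat_orth (m k l : ℕ) (hk : k < m) (hl : l < m) (hkl : k ≠ l) :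
    ∑ i ∈ Finset.range (2^m), Qmat m (nbc m) i k * Qmat m (nbc m) i l = 0 := by
  refine Finset.sum_involution (fun i _ => i ^^^ 2^k) ?_ ?_ ?_ ?_
  · intro i _
    simp only [Qmat_nbc m _ k hk, Qmat_nbc m _ l hl, Nat.testBit_xor, Nat.testBit_two_pow]
    cases Nat.testBit i k <;> cases Nat.testBit i l <;> simp [hkl]
  · intro i _ _ h
    have h2 := congrArg (fun n => Nat.testBit n k) h
    simp [Nat.testBit_xor] at h2
  · intro i hi
    rw [Finset.mem_range] at *
    exact Nat.xor_lt_two_pow hi (Nat.pow_lt_pow_right (by norm_num) hk)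
  · intro i _
    simp [Nat.xor_assoc]

lemma Qmat_sq (m k : ℕ) (i : ℕ) : Qmat m (nbc m) i k * Qmat m (nbc m) i k = 1 := by
  unfold Qmat; split_ifs <;> norm_num

/-- A hierarchical one-dimensional input alphabet
`x_i = Σ_{k<m} (2 b_k(i) - 1) d_k` with `d_k > 0` satisfies `X = Q(N_m)·V` with
`V = (-d_0, …, -d_{m-1})ᵀ`, and consequently the constellation `[X, N_m, U_M]` is
first-order optimal. -/
theorem hierarchical_nbc_foo (m : ℕ) (hm : 1 ≤ m)
    (d : ℕ → ℝ) (hd : ∀ k < m, 0 < d k)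
    (x : ℕ → ℝ)
    (hx : ∀ i < 2^m, x i = ∑ k ∈ Finset.range m,
        (2 * (if Nat.testBit i k then (1:ℝ) else 0) - 1) * d k) :
    (∀ i < 2^m, x i = ∑ k ∈ Finset.range m, Qmat m (nbc m) i k * (- d k)) ∧
    ∑ k ∈ Finset.range m,
        ((2^m : ℝ)⁻¹ * ∑ i ∈ Finset.range (2^m), Qmat m (nbc m) i k * x i)^2
      = (2^m : ℝ)⁻¹ * ∑ i ∈ Finset.range (2^m), x i ^ 2 := by
  have h1 : ∀ i < 2^m, x i = ∑ k ∈ Finset.range m, Qmat m (nbc m) i k * (- d k) := by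
    intro i hi
    rw [hx i hi]
    refine Finset.sum_congr rfl fun k hk => ?_
    rw [Qmat_nbc m i k (Finset.mem_range.1 hk)]
    split_ifs <;> ring
  have hM : (2^m : ℝ) ≠ 0 := by positivity
  have h2 : ∀ k ∈ Finset.range m,
      (2^m : ℝ)⁻¹ * ∑ i ∈ Finset.range (2^m), Qmat m (nbc m) i k * x i = - d k := by
    intro k hk
    have : ∑ i ∈ Finset.range (2^m), Qmat m (nbc m) i k * x i
        = ∑ l ∈ Finset.range m, (∑ i ∈ Finset.range (2^m),
            Qmat m (nbc m) i k * Qmat m (nbc m) i l) * (- d l) := by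
      simp_rw [Finset.sum_mul]
      rw [Finset.sum_comm]
      refine Finset.sum_congr rfl fun i hi => ?_
      rw [h1 i (Finset.mem_range.1 hi), Finset.mul_sum]
      exact Finset.sum_congr rfl fun l _ => by ring
    rw [this, Finset.sum_eq_single_of_mem k hk]
    · simp only [Qmat_sq, Finset.sum_const, Finset.card_range, nsmul_eq_mul]
      push_cast
      field_simp
    · intro l hl hlk
      rw [Qmat_orth m k l (Finset.mem_range.1 hk) (Finset.mem_range.1 hl) hlk.symm, zero_mul]
  refine ⟨h1, ?_⟩
  have h3 : ∑ i ∈ Finset.range (2^m), x i ^ 2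
      = ∑ k ∈ Finset.range m,
        (∑ i ∈ Finset.range (2^m), Qmat m (nbc m) i k * x i) * (- d k) := by
    simp_rw [Finset.sum_mul]
    rw [Finset.sum_comm]
    refine Finset.sum_congr rfl fun i hi => ?_
    rw [sq]
    nth_rewrite 2 [h1 i (Finset.mem_range.1 hi)]
    rw [Finset.mul_sum]
    exact Finset.sum_congr rfl fun l _ => by ring
  rw [h3, Finset.mul_sum]
  refine Finset.sum_congr rfl fun k hk => ?_
  rw [← mul_assoc, h2 k hk, sq]
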